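/- Let χ < 0, n ≥ 1 and k ≥ 1 be integers with 6χ + 3n ≤ 3. Let r be the unique positive real with (6 − (6χ+3n)/k)·α(r) + (2n/k)·β(r) = 2π, and let r₀ be the unique positive real with (6 − 6χ/k)·α(r₀) = 2π. Then r < r₀. -/

import Mathlib

open Real

/-- The vertex angle of a hyperbolic equilateral triangle with side length `2r`. -/
noncomputable def hypAlpha (r : ℝ) : ℝ := 2 * Real.arcsin (1 / (2 * Real.cosh r))

/-- The angle at a finite vertex of a horocyclic ideal triangle with compact side
length `2r`. -/
noncomputable def hypBeta (r : ℝ) : ℝ := Real.arcsin (1 / Real.cosh r)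

theorem aux_beta_lt (r : ℝ) (hr : 0 < r) : 2 * hypBeta r < 3 * hypAlpha r := by
  unfold hypBeta hypAlpha
  have hc : 1 < Real.cosh r := Real.one_lt_cosh.2 hr.ne'
  obtain ⟨s, hs⟩ : ∃ s, s = 1 / Real.cosh r := ⟨_, rfl⟩
  have hs2 : 1 / (2 * Real.cosh r) = s / 2 := by rw [hs]; field_simp
  have hs0 : 0 < s := by rw [hs]; positivity
  have hs1 : s < 1 := by rw [hs, div_lt_one (by linarith)]; exact hc
  rw [hs2, ← hs]
  obtain ⟨t, ht⟩ : ∃ t, t = Real.arcsin (s / 2) := ⟨_, rfl⟩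
  rw [← ht]
  have hsin : Real.sin t = s / 2 := by
    rw [ht]; exact Real.sin_arcsin (by linarith) (by linarith)
  have ht0 : 0 < t := by rw [ht]; exact Real.arcsin_pos.2 (by linarith)
  have ht6 : t < π / 6 := by
    rw [ht, Real.arcsin_lt_iff_lt_sin' ⟨by linarith [Real.pi_pos], by linarith [Real.pi_pos]⟩,
      Real.sin_pi_div_six]
    linarith
  have h3 : Real.arcsin s < 3 * t := by
    rw [Real.arcsin_lt_iff_lt_sin' ⟨by linarith [Real.pi_pos], by linarith [Real.pi_pos]⟩,
      Real.sin_three_mul, hsin]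
    nlinarith [mul_pos hs0 (mul_pos (sub_pos.2 hs1) (by linarith : (0:ℝ) < 1 + s))]
  linarith

theorem stmt_4 (χ n k : ℤ) (hχ : χ < 0) (hn : 1 ≤ n) (hk : 1 ≤ k)
    (hcond : 6 * χ + 3 * n ≤ 3) (r r₀ : ℝ) (hr : 0 < r) (hr₀ : 0 < r₀)
    (heq : (6 - ((6 * χ + 3 * n : ℤ) : ℝ) / (k : ℝ)) * hypAlpha r
        + (((2 * n : ℤ) : ℝ) / (k : ℝ)) * hypBeta r = 2 * Real.pi)
    (heq₀ : (6 - ((6 * χ : ℤ) : ℝ) / (k : ℝ)) * hypAlpha r₀ = 2 * Real.pi) :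
    r < r₀ := by
  by_contra! h
  have hα : hypAlpha r ≤ hypAlpha r₀ := by
    unfold hypAlpha
    have hc : Real.cosh r₀ ≤ Real.cosh r := by
      rw [Real.cosh_le_cosh, abs_of_pos hr, abs_of_pos hr₀]; exact h
    have h0 := Real.cosh_pos r₀
    have := Real.monotone_arcsin (one_div_le_one_div_of_le (by linarith : 0 < 2 * Real.cosh r₀)
      (by linarith : 2 * Real.cosh r₀ ≤ 2 * Real.cosh r))
    linarith
  have hb := aux_beta_lt r hr
  have hk' : (0:ℝ) < k := by exact_mod_cast (by omega : 0 < k)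
  have hn' : (0:ℝ) < n := by exact_mod_cast (by omega : 0 < n)
  have hχ' : (χ:ℝ) < 0 := by exact_mod_cast hχ
  push_cast at heq heq₀
  have hC : 0 < 6 - 6 * (χ:ℝ) / k := by
    have : 6 * (χ:ℝ) / k < 0 := div_neg_of_neg_of_pos (by linarith) hk'
    linarith
  have h1 := mul_le_mul_of_nonneg_left hα hC.le
  have h2 := mul_pos (div_pos hn' hk') (sub_pos.2 hb)
  have h3 : (6 - (6 * (χ:ℝ) + 3 * n) / k) * hypAlpha r + 2 * n / k * hypBeta r
    = (6 - 6 * (χ:ℝ) / k) * hypAlpha r - n / k * (3 * hypAlpha r - 2 * hypBeta r) := by ring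
  linarith
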